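/- Let μ₂ ∈ (0,1). For each ε₀ ∈ (0, R₀) there exist r̄₁* ∈ (r₀, r₀ + R₀ − ε₀] and δ₁ > 0, depending only on (γ, r₀, b₀, ρ₀, U₀, S₀, E₀, μ₂, ε₀), with the following property. Let r₁ ∈ (r₀, r̄₁*); then there exists a constant C > 0 such that: whenever B₁₁, B₁₂, B₂₂ ∈ C^∞(closure of N) satisfy (a) μ₂ ≤ −B₁₁ ≤ 1/μ₂ and μ₂ ≤ B₂₂ ≤ 1/μ₂ on the closure of N; (b) B₁₂ = 0 on z = ±1; (c) the C¹(closure of N)-norms of B₁₁ − B̄₁₁, B₂₂ − B̄₂₂ and B₁₂ are each at most δ₁; and whenever ψ, Ψ ∈ C²(closure of N) and continuous functions G₄, G₅ on the closure of N and G₆ on [−1,1] satisfy, in N, B₁₁∂_r²ψ + B₂₂∂_z²ψ + 2B₁₂∂²_{rz}ψ + ā₁∂_rψ + b̄₁∂_rΨ + b̄₂Ψ = G₄ and ∂_r²Ψ + (1/r)∂_rΨ + ∂_z²Ψ + ā₂∂_rψ − b̄₃Ψ = G₅, with boundary conditions ψ(r₀,z) = 0, ∂_rψ(r₀,z) = G₆(z),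 ∂_rΨ(r₀,z) = 0, Ψ(r₁,z) = 0, and ∂_zψ = ∂_zΨ = 0 on z = ±1; then ∫_N (ψ² + (∂_rψ)² + (∂_zψ)² + Ψ² + (∂_rΨ)² + (∂_zΨ)²) dr dz ≤ C (∫_N (G₄² + G₅²) dr dz + ∫_{−1}^{1} G₆² dz). -/

import Mathlib

open Set MeasureTheory

/-- The open rectangle `N = (r₀, r₁) × (−1, 1)` in the coordinates `(r, z)`. -/
def NRect (r₀ r₁ : ℝ) : Set (ℝ × ℝ) := Ioo r₀ r₁ ×ˢ Ioo (-1 : ℝ) 1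

/-- unit direction `e_r` in the `(r, z)`-plane. -/
def er2 : ℝ × ℝ := (1, 0)
/-- unit direction `e_z` in the `(r, z)`-plane. -/
def ez2 : ℝ × ℝ := (0, 1)

/-- Directional derivative (within a set) of a function on `ℝ²`. -/
noncomputable def pdv2 (S : Set (ℝ × ℝ)) (v : ℝ × ℝ) (f : ℝ × ℝ → ℝ) : ℝ × ℝ → ℝ :=
  fun p => fderivWithin ℝ f S p v

/-- Background density `ρ̄(r) = J₀/(r Ū(r))`. -/
noncomputable def rhoBar (J₀ : ℝ) (U : ℝ → ℝ) (r : ℝ) : ℝ := J₀ / (r * U r)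

/-- Background squared sound speed `c̄²(r) = γ e^{S₀} ρ̄(r)^{γ−1}`. -/
noncomputable def c2Bar (γ S₀ J₀ : ℝ) (U : ℝ → ℝ) (r : ℝ) : ℝ :=
  γ * Real.exp S₀ * rhoBar J₀ U r ^ (γ - 1)

/-- Background coefficient `ā₁ = (c̄² − (γ−1)Ū²)/r − (γ+1)ŪŪ′ + Ē`. -/
noncomputable def a1Bar (γ S₀ J₀ : ℝ) (U U' E : ℝ → ℝ) (r : ℝ) : ℝ :=
  (c2Bar γ S₀ J₀ U r - (γ - 1) * (U r) ^ 2) / r - (γ + 1) * (U r * U' r) + E r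

/-- Background coefficient `ā₂ = ρ̄Ū/c̄²`. -/
noncomputable def a2Bar (γ S₀ J₀ : ℝ) (U : ℝ → ℝ) (r : ℝ) : ℝ :=
  rhoBar J₀ U r * U r / c2Bar γ S₀ J₀ U r

/-- Background coefficient `b̄₂ = (γ−1)Ū′ + (γ−1)Ū/r`. -/
noncomputable def b2Bar (γ : ℝ) (U U' : ℝ → ℝ) (r : ℝ) : ℝ :=
  (γ - 1) * U' r + (γ - 1) * U r / r

/-- Background coefficient `b̄₃ = ρ̄/c̄²`. -/
noncomputable def b3Bar (γ S₀ J₀ : ℝ) (U : ℝ → ℝ) (r : ℝ) : ℝ :=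
  rhoBar J₀ U r / c2Bar γ S₀ J₀ U r

/-- Background principal coefficient `B̄₁₁ = c̄² − Ū²`. -/
noncomputable def B11Bar (γ S₀ J₀ : ℝ) (U : ℝ → ℝ) (r : ℝ) : ℝ :=
  c2Bar γ S₀ J₀ U r - (U r) ^ 2

lemma closure_NRect {r₀ r₁ : ℝ} (h : r₀ < r₁) :
    closure (NRect r₀ r₁) = Icc r₀ r₁ ×ˢ Icc (-1 : ℝ) 1 := by
  rw [NRect, closure_prod_eq, closure_Ioo h.ne, closure_Ioo (by norm_num)]

lemma isOpen_NRect (r₀ r₁ : ℝ) : IsOpen (NRect r₀ r₁) := isOpen_Ioo.prod isOpen_Ioo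

lemma isCompact_closure_NRect {r₀ r₁ : ℝ} (h : r₀ < r₁) :
    IsCompact (closure (NRect r₀ r₁)) := by
  rw [closure_NRect h]
  exact isCompact_Icc.prod isCompact_Icc

lemma uniqueDiffOn_closure_NRect {r₀ r₁ : ℝ} (h : r₀ < r₁) :
    UniqueDiffOn ℝ (closure (NRect r₀ r₁)) := by
  rw [closure_NRect h]
  exact (uniqueDiffOn_Icc h).prod (uniqueDiffOn_Icc (by norm_num))

lemma NRect_ae_eq_closure {r₀ r₁ : ℝ} (h : r₀ < r₁) :
    NRect r₀ r₁ =ᵐ[volume] closure (NRect r₀ r₁) := by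
  rw [closure_NRect h]
  exact Measure.set_prod_ae_eq Ioo_ae_eq_Icc Ioo_ae_eq_Icc

lemma contDiffOn_pdv2 {S : Set (ℝ × ℝ)} (hS : UniqueDiffOn ℝ S) {f : ℝ × ℝ → ℝ}
    (hf : ContDiffOn ℝ 2 f S) (v : ℝ × ℝ) : ContDiffOn ℝ 1 (pdv2 S v f) S :=
  (hf.fderivWithin hS (by norm_num)).clm_apply contDiffOn_const

lemma continuousOn_pdv2 {S : Set (ℝ × ℝ)} (hS : UniqueDiffOn ℝ S) {f : ℝ × ℝ → ℝ}
    (hf : ContDiffOn ℝ 1 f S) (v : ℝ × ℝ) : ContinuousOn (pdv2 S v f) S :=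
  (hf.continuousOn_fderivWithin hS le_rfl).clm_apply continuousOn_const

lemma pdv2_comm {r₀ r₁ : ℝ} (h : r₀ < r₁) {f : ℝ × ℝ → ℝ}
    (hf : ContDiffOn ℝ 2 f (closure (NRect r₀ r₁))) (v w : ℝ × ℝ) {p : ℝ × ℝ}
    (hp : p ∈ NRect r₀ r₁) :
    pdv2 (closure (NRect r₀ r₁)) v (pdv2 (closure (NRect r₀ r₁)) w f) p
      = pdv2 (closure (NRect r₀ r₁)) w (pdv2 (closure (NRect r₀ r₁)) v f) p := by
  have hS := uniqueDiffOn_closure_NRect h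
  have hpS := subset_closure hp
  have hd : DifferentiableWithinAt ℝ (fderivWithin ℝ f (closure (NRect r₀ r₁)))
      (closure (NRect r₀ r₁)) p :=
    ((hf.fderivWithin hS (m := 1) (by norm_num)).differentiableOn (by norm_num)) p hpS
  have key : ∀ a b : ℝ × ℝ,
      pdv2 (closure (NRect r₀ r₁)) a (pdv2 (closure (NRect r₀ r₁)) b f) p
        = fderivWithin ℝ (fderivWithin ℝ f (closure (NRect r₀ r₁))) (closure (NRect r₀ r₁)) p a b := by
    intro a b
    change fderivWithin ℝ (fun y => fderivWithin ℝ f (closure (NRect r₀ r₁)) y b) _ p a = _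
    rw [fderivWithin_clm_apply (hS p hpS) hd (differentiableWithinAt_const b)]
    simp
  rw [key, key]
  have hint : p ∈ interior (closure (NRect r₀ r₁)) :=
    (isOpen_NRect r₀ r₁).subset_interior_iff.2 subset_closure hp
  exact (hf p hpS).isSymmSndFDerivWithinAt (by simp) hS (subset_closure hint) hpS v w

lemma hasDerivWithinAt_slice_r {r₀ r₁ : ℝ} (h : r₀ < r₁) {f : ℝ × ℝ → ℝ} {p : ℝ × ℝ}
    (hp : p ∈ closure (NRect r₀ r₁))
    (hf : DifferentiableWithinAt ℝ f (closure (NRect r₀ r₁)) p) :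
    HasDerivWithinAt (fun t => f (t, p.2)) (pdv2 (closure (NRect r₀ r₁)) er2 f p)
      (Icc r₀ r₁) p.1 := by
  have hg : HasDerivWithinAt (fun t : ℝ => (t, p.2)) er2 (Icc r₀ r₁) p.1 :=
    (hasDerivWithinAt_id _ _).prodMk (hasDerivWithinAt_const _ _ _)
  refine HasFDerivWithinAt.comp_hasDerivWithinAt (t := closure (NRect r₀ r₁)) p.1
    hf.hasFDerivWithinAt hg ?_
  rw [closure_NRect h] at hp ⊢
  exact fun t ht => ⟨ht, hp.2⟩

lemma hasDerivWithinAt_slice_z {r₀ r₁ : ℝ} (h : r₀ < r₁) {f : ℝ × ℝ → ℝ} {p : ℝ × ℝ}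
    (hp : p ∈ closure (NRect r₀ r₁))
    (hf : DifferentiableWithinAt ℝ f (closure (NRect r₀ r₁)) p) :
    HasDerivWithinAt (fun t => f (p.1, t)) (pdv2 (closure (NRect r₀ r₁)) ez2 f p)
      (Icc (-1) 1) p.2 := by
  have hg : HasDerivWithinAt (fun t : ℝ => (p.1, t)) ez2 (Icc (-1) 1) p.2 :=
    (hasDerivWithinAt_const _ _ _).prodMk (hasDerivWithinAt_id _ _)
  refine HasFDerivWithinAt.comp_hasDerivWithinAt (t := closure (NRect r₀ r₁)) p.2
    hf.hasFDerivWithinAt hg ?_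
  rw [closure_NRect h] at hp ⊢
  exact fun t ht => ⟨hp.1, ht⟩

lemma hasDerivAt_slice_r {r₀ r₁ : ℝ} (h : r₀ < r₁) {f : ℝ × ℝ → ℝ}
    (hf : ContDiffOn ℝ 1 f (closure (NRect r₀ r₁))) {p : ℝ × ℝ} (hp : p ∈ NRect r₀ r₁) :
    HasDerivAt (fun t => f (t, p.2)) (pdv2 (closure (NRect r₀ r₁)) er2 f p) p.1 :=
  (hasDerivWithinAt_slice_r h (subset_closure hp)
    ((hf.differentiableOn (by norm_num)) p (subset_closure hp))).hasDerivAt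
    (Icc_mem_nhds hp.1.1 hp.1.2)

lemma hasDerivAt_slice_z {r₀ r₁ : ℝ} (h : r₀ < r₁) {f : ℝ × ℝ → ℝ}
    (hf : ContDiffOn ℝ 1 f (closure (NRect r₀ r₁))) {p : ℝ × ℝ} (hp : p ∈ NRect r₀ r₁) :
    HasDerivAt (fun t => f (p.1, t)) (pdv2 (closure (NRect r₀ r₁)) ez2 f p) p.2 :=
  (hasDerivWithinAt_slice_z h (subset_closure hp)
    ((hf.differentiableOn (by norm_num)) p (subset_closure hp))).hasDerivAt
    (Icc_mem_nhds hp.2.1 hp.2.2)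

lemma integrableOn_NRect {r₀ r₁ : ℝ} (h : r₀ < r₁) {f : ℝ × ℝ → ℝ}
    (hf : ContinuousOn f (closure (NRect r₀ r₁))) : IntegrableOn f (NRect r₀ r₁) :=
  (hf.integrableOn_compact (isCompact_closure_NRect h)).mono_set subset_closure

/-- The divergence theorem on the rectangle, for a field that is `C¹` up to the boundary. -/
lemma integral_NRect_divergence {r₀ r₁ : ℝ} (h : r₀ < r₁) {F G : ℝ × ℝ → ℝ}
    (hF : ContDiffOn ℝ 1 F (closure (NRect r₀ r₁)))
    (hG : ContDiffOn ℝ 1 G (closure (NRect r₀ r₁))) :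
    ∫ p in NRect r₀ r₁, (pdv2 (closure (NRect r₀ r₁)) er2 F p
        + pdv2 (closure (NRect r₀ r₁)) ez2 G p)
      = (((∫ x in r₀..r₁, G (x, 1)) - ∫ x in r₀..r₁, G (x, -1))
          + ∫ z in (-1 : ℝ)..1, F (r₁, z)) - ∫ z in (-1 : ℝ)..1, F (r₀, z) := by
  have hS := uniqueDiffOn_closure_NRect h
  have hK : closure (NRect r₀ r₁) = Icc (r₀, (-1 : ℝ)) (r₁, 1) := by
    rw [closure_NRect h, Icc_prod_Icc]
  have hd : ∀ f : ℝ × ℝ → ℝ, ContDiffOn ℝ 1 f (closure (NRect r₀ r₁)) → ∀ x ∈ NRect r₀ r₁,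
      HasFDerivAt f (fderivWithin ℝ f (closure (NRect r₀ r₁)) x) x := fun f hf x hx =>
    ((hf.differentiableOn (by norm_num)) x (subset_closure hx)).hasFDerivWithinAt.hasFDerivAt
      (Filter.mem_of_superset ((isOpen_NRect r₀ r₁).mem_nhds hx) subset_closure)
  have hi := ((continuousOn_pdv2 hS hF er2).add
    (continuousOn_pdv2 hS hG ez2)).integrableOn_compact (μ := volume) (isCompact_closure_NRect h)
  rw [setIntegral_congr_set (NRect_ae_eq_closure h)]
  have := integral_divergence_prod_Icc_of_hasFDerivAt_of_le F G
    (fderivWithin ℝ F (closure (NRect r₀ r₁))) (fderivWithin ℝ G (closure (NRect r₀ r₁)))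
    (r₀, -1) (r₁, 1) ⟨h.le, by norm_num⟩ (hK ▸ hF.continuousOn) (hK ▸ hG.continuousOn)
    (hd F hF) (hd G hG) (by rw [← hK]; exact hi)
  rw [← hK] at this
  exact this

/-- Coercivity of the divergence of the energy field, for weights `w`, `s` that are small
compared with the size `M` of the coefficients. -/
lemma energy_pointwise {μ M K w s A D Ar Dr Dz bz a₁ U b₂ a₂ b₃ i ψ u v Ψ P Q g₄ g₅ : ℝ}
    (hμ : 0 < μ) (hμ1 : μ < 1) (hM : 1 ≤ M) (hK : K = 2 + M ^ 2 + 2 * M ^ 2 / μ)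
    (hw : 0 ≤ w) (hs : 0 ≤ s) (hwM : w * (20 * M) ≤ μ / 8) (hsK : s * K ≤ μ / 8)
    (hA : μ ≤ A) (hD : μ ≤ D) (hAr : |Ar| ≤ M) (hDr : |Dr| ≤ M) (hDz : |Dz| ≤ M)
    (hbz : |bz| ≤ M) (ha₁ : |a₁| ≤ M) (hU : |U| ≤ M) (hb₂ : |b₂| ≤ M) (ha₂ : |a₂| ≤ M)
    (hb₃ : 0 ≤ b₃) (hi : |i| ≤ M) :
    μ / 4 * (ψ ^ 2 + u ^ 2 + v ^ 2 + Ψ ^ 2 + P ^ 2 + Q ^ 2) - (g₄ ^ 2 + g₅ ^ 2) ≤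
      (A * u ^ 2 + D * v ^ 2) / 2 + ψ ^ 2 + P ^ 2 + Q ^ 2 + K * Ψ ^ 2
        - w * (Ar * u ^ 2 / 2 + Dr * v ^ 2 / 2) + w * Dz * u * v + w * bz * u ^ 2
        - 2 * w * ψ * u + 2 * K * s * Ψ * P
        + w * u * (g₄ - a₁ * u - U * P - b₂ * Ψ) + Ψ * (g₅ - i * P - a₂ * u + b₃ * Ψ) := by
  -- a bounded coefficient times a product is controlled by the squares
  have young : ∀ {c x y : ℝ}, |c| ≤ M → -(M * (x ^ 2 + y ^ 2) / 2) ≤ c * (x * y) := by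
    intro c x y hc
    have h1 : |c * (x * y)| ≤ M * ((x ^ 2 + y ^ 2) / 2) := by
      rw [abs_mul]
      refine mul_le_mul hc ?_ (abs_nonneg _) (by linarith)
      rw [abs_le]; constructor <;> nlinarith [sq_nonneg (x + y), sq_nonneg (x - y)]
    linarith [neg_abs_le (c * (x * y))]
  have neg : ∀ {c : ℝ}, |c| ≤ M → |-c| ≤ M := fun h => by rwa [abs_neg]
  have one : |(1 : ℝ)| ≤ M := by simpa using hM
  have E1 := young (x := u) (y := u) (neg hAr)
  have E2 := young (x := v) (y := v) (neg hDr)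
  have E3 := young (x := u) (y := v) hDz
  have E4 := young (x := u) (y := u) hbz
  have E5 := young (x := ψ) (y := u) (neg one)
  have E6 := young (x := u) (y := g₄) one
  have E7 := young (x := u) (y := u) (neg ha₁)
  have E8 := young (x := u) (y := P) (neg hU)
  have E9 := young (x := u) (y := Ψ) (neg hb₂)
  have hyp : -(μ / 8 * (u ^ 2 + v ^ 2 + ψ ^ 2 + P ^ 2 + Ψ ^ 2 + g₄ ^ 2)) ≤
      w * (-Ar * (u * u) / 2 + -Dr * (v * v) / 2 + Dz * (u * v) + bz * (u * u)
        + 2 * (-1 * (ψ * u)) + 1 * (u * g₄) + -a₁ * (u * u) + -U * (u * P) + -b₂ * (u * Ψ)) := by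
    have h1 : -(20 * M * (u ^ 2 + v ^ 2 + ψ ^ 2 + P ^ 2 + Ψ ^ 2 + g₄ ^ 2)) ≤
        -Ar * (u * u) / 2 + -Dr * (v * v) / 2 + Dz * (u * v) + bz * (u * u)
        + 2 * (-1 * (ψ * u)) + 1 * (u * g₄) + -a₁ * (u * u) + -U * (u * P) + -b₂ * (u * Ψ) := by
      have m1 : 0 ≤ M * u ^ 2 := by positivity
      have m2 : 0 ≤ M * v ^ 2 := by positivity
      have m3 : 0 ≤ M * ψ ^ 2 := by positivity
      have m4 : 0 ≤ M * P ^ 2 := by positivity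
      have m5 : 0 ≤ M * Ψ ^ 2 := by positivity
      have m6 : 0 ≤ M * g₄ ^ 2 := by positivity
      linarith only [E1, E2, E3, E4, E5, E6, E7, E8, E9, m1, m2, m3, m4, m5, m6]
    have h2 := mul_le_mul_of_nonneg_left h1 hw
    have h3 := mul_le_mul_of_nonneg_right hwM
      (show 0 ≤ u ^ 2 + v ^ 2 + ψ ^ 2 + P ^ 2 + Ψ ^ 2 + g₄ ^ 2 by positivity)
    linarith only [h2, h3]
  have hΨP : -(μ / 8 * (Ψ ^ 2 + P ^ 2)) ≤ 2 * K * s * Ψ * P := by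
    have hK0 : 0 ≤ K := by rw [hK]; positivity
    have h1 := mul_nonneg (mul_nonneg hs hK0) (sq_nonneg (Ψ + P))
    have h2 := mul_le_mul_of_nonneg_right hsK (show 0 ≤ Ψ ^ 2 + P ^ 2 by positivity)
    linarith only [h1, h2]
  have hiP : -(P ^ 2 / 4 + M ^ 2 * Ψ ^ 2) ≤ -i * (Ψ * P) := by
    have h1 : i ^ 2 ≤ M ^ 2 := sq_le_sq' (by linarith [neg_abs_le i]) (by linarith [le_abs_self i])
    have h2 := mul_le_mul_of_nonneg_right h1 (sq_nonneg Ψ)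
    linarith only [h2, sq_nonneg (P / 2 - i * Ψ)]
  have ha₂u : -(μ / 8 * u ^ 2 + 2 * M ^ 2 / μ * Ψ ^ 2) ≤ -a₂ * (Ψ * u) := by
    have h1 : a₂ ^ 2 ≤ M ^ 2 :=
      sq_le_sq' (by linarith [neg_abs_le a₂]) (by linarith [le_abs_self a₂])
    have h2 := mul_le_mul_of_nonneg_right h1 (show 0 ≤ 2 / μ * Ψ ^ 2 from mul_nonneg (by positivity) (sq_nonneg Ψ))
    have h3 : 0 ≤ μ / 8 * (u - 4 * a₂ * Ψ / μ) ^ 2 := mul_nonneg (by linarith) (sq_nonneg _)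
    have h4 : μ / 8 * (u - 4 * a₂ * Ψ / μ) ^ 2
        = μ / 8 * u ^ 2 - a₂ * (Ψ * u) + a₂ ^ 2 * (2 / μ * Ψ ^ 2) := by
      field_simp; ring
    have h5 : M ^ 2 * (2 / μ * Ψ ^ 2) = 2 * M ^ 2 / μ * Ψ ^ 2 := by ring
    linarith only [h2, h3, h4, h5]
  have hg₅ : -(Ψ ^ 2 / 2 + g₅ ^ 2 / 2) ≤ Ψ * g₅ := by linarith only [sq_nonneg (Ψ + g₅)]
  have hAu := mul_le_mul_of_nonneg_right hA (sq_nonneg u)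
  have hDv := mul_le_mul_of_nonneg_right hD (sq_nonneg v)
  have hb := mul_nonneg hb₃ (sq_nonneg Ψ)
  have hKΨ : K * Ψ ^ 2 = 2 * Ψ ^ 2 + M ^ 2 * Ψ ^ 2 + 2 * M ^ 2 / μ * Ψ ^ 2 := by rw [hK]; ring
  have q : ∀ x : ℝ, μ * x ^ 2 ≤ 1 * x ^ 2 := fun x =>
    mul_le_mul_of_nonneg_right hμ1.le (sq_nonneg x)
  have p : ∀ x : ℝ, 0 ≤ μ * x ^ 2 := fun x => by positivity
  linarith only [hyp, hΨP, hiP, ha₂u, hg₅, hAu, hDv, hb, hKΨ, q ψ, q Ψ, q P, q Q, q g₄, p u, p v, sq_nonneg ψ, sq_nonneg Ψ, sq_nonneg P,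
    sq_nonneg Q, sq_nonneg g₄, sq_nonneg g₅]

/-- `H¹` estimate for the coupled system on a short rectangle, for abstract coefficients. -/
lemma coupled_energy_estimate {r₀ r₁ μ M : ℝ} (h : r₀ < r₁) (hμ : 0 < μ) (hμ1 : μ < 1)
    (hM : 1 ≤ M) (hL : (r₁ - r₀) * (20 * M) ≤ μ / 8)
    (hLK : (r₁ - r₀) * (2 + M ^ 2 + 2 * M ^ 2 / μ) ≤ μ / 8)
    {a₁ U b₂ a₂ b₃ : ℝ → ℝ}
    (hcoef : ∀ r ∈ Ioo r₀ r₁, |a₁ r| ≤ M ∧ |U r| ≤ M ∧ |b₂ r| ≤ M ∧ |a₂ r| ≤ M ∧ 0 ≤ b₃ r ∧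
      |1 / r| ≤ M)
    {B11 B12 B22 : ℝ × ℝ → ℝ}
    (h11 : ContDiffOn ℝ 1 B11 (closure (NRect r₀ r₁)))
    (h12 : ContDiffOn ℝ 1 B12 (closure (NRect r₀ r₁)))
    (h22 : ContDiffOn ℝ 1 B22 (closure (NRect r₀ r₁)))
    (hB : ∀ p ∈ closure (NRect r₀ r₁), μ ≤ -B11 p ∧ -B11 p ≤ 1 / μ ∧ μ ≤ B22 p)
    (hwall : ∀ p ∈ closure (NRect r₀ r₁), (p.2 = 1 ∨ p.2 = -1) → B12 p = 0)
    (hdB : ∀ p ∈ NRect r₀ r₁, |pdv2 (closure (NRect r₀ r₁)) er2 B11 p| ≤ M ∧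
      |pdv2 (closure (NRect r₀ r₁)) er2 B22 p| ≤ M ∧
      |pdv2 (closure (NRect r₀ r₁)) ez2 B22 p| ≤ M ∧
      |pdv2 (closure (NRect r₀ r₁)) ez2 B12 p| ≤ M)
    {ψ Ψ G₄ G₅ : ℝ × ℝ → ℝ} {G₆ : ℝ → ℝ}
    (hψ : ContDiffOn ℝ 2 ψ (closure (NRect r₀ r₁)))
    (hΨ : ContDiffOn ℝ 2 Ψ (closure (NRect r₀ r₁)))
    (hG₄ : ContinuousOn G₄ (closure (NRect r₀ r₁)))
    (hG₅ : ContinuousOn G₅ (closure (NRect r₀ r₁)))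
    (hG₆ : ContinuousOn G₆ (Icc (-1 : ℝ) 1))
    (hhyp : ∀ p ∈ NRect r₀ r₁,
      B11 p * pdv2 (closure (NRect r₀ r₁)) er2 (pdv2 (closure (NRect r₀ r₁)) er2 ψ) p
        + B22 p * pdv2 (closure (NRect r₀ r₁)) ez2 (pdv2 (closure (NRect r₀ r₁)) ez2 ψ) p
        + 2 * B12 p * pdv2 (closure (NRect r₀ r₁)) ez2 (pdv2 (closure (NRect r₀ r₁)) er2 ψ) p
        + a₁ p.1 * pdv2 (closure (NRect r₀ r₁)) er2 ψ p
        + U p.1 * pdv2 (closure (NRect r₀ r₁)) er2 Ψ p + b₂ p.1 * Ψ p = G₄ p)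
    (hell : ∀ p ∈ NRect r₀ r₁,
      pdv2 (closure (NRect r₀ r₁)) er2 (pdv2 (closure (NRect r₀ r₁)) er2 Ψ) p
        + (1 / p.1) * pdv2 (closure (NRect r₀ r₁)) er2 Ψ p
        + pdv2 (closure (NRect r₀ r₁)) ez2 (pdv2 (closure (NRect r₀ r₁)) ez2 Ψ) p
        + a₂ p.1 * pdv2 (closure (NRect r₀ r₁)) er2 ψ p - b₃ p.1 * Ψ p = G₅ p)
    (hends : ∀ z ∈ Icc (-1 : ℝ) 1, ψ (r₀, z) = 0 ∧
      pdv2 (closure (NRect r₀ r₁)) er2 ψ (r₀, z) = G₆ z ∧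
      pdv2 (closure (NRect r₀ r₁)) er2 Ψ (r₀, z) = 0 ∧ Ψ (r₁, z) = 0)
    (hwalls : ∀ p ∈ closure (NRect r₀ r₁), (p.2 = 1 ∨ p.2 = -1) →
      pdv2 (closure (NRect r₀ r₁)) ez2 ψ p = 0 ∧ pdv2 (closure (NRect r₀ r₁)) ez2 Ψ p = 0) :
    μ / 4 * (∫ p in NRect r₀ r₁, ((ψ p) ^ 2 + (pdv2 (closure (NRect r₀ r₁)) er2 ψ p) ^ 2
        + (pdv2 (closure (NRect r₀ r₁)) ez2 ψ p) ^ 2 + (Ψ p) ^ 2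
        + (pdv2 (closure (NRect r₀ r₁)) er2 Ψ p) ^ 2
        + (pdv2 (closure (NRect r₀ r₁)) ez2 Ψ p) ^ 2))
      ≤ (∫ p in NRect r₀ r₁, ((G₄ p) ^ 2 + (G₅ p) ^ 2))
        + (r₁ - r₀) / (2 * μ) * ∫ z in (-1 : ℝ)..1, (G₆ z) ^ 2 := by
  have hS := uniqueDiffOn_closure_NRect h
  have mem : ∀ {r z : ℝ}, r ∈ Icc r₀ r₁ → z ∈ Icc (-1 : ℝ) 1 → (r, z) ∈ closure (NRect r₀ r₁) :=
    fun hr hz => by rw [closure_NRect h]; exact ⟨hr, hz⟩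
  obtain ⟨K, hK⟩ : ∃ K, K = 2 + M ^ 2 + 2 * M ^ 2 / μ := ⟨_, rfl⟩
  rw [← hK] at hLK
  have hK0 : 0 ≤ K := by rw [hK]; positivity
  have hu := contDiffOn_pdv2 hS hψ er2
  have hv := contDiffOn_pdv2 hS hψ ez2
  have hP := contDiffOn_pdv2 hS hΨ er2
  have hQ := contDiffOn_pdv2 hS hΨ ez2
  have hψ1 := hψ.of_le (show (1 : WithTop ℕ∞) ≤ 2 by norm_num)
  have hΨ1 := hΨ.of_le (show (1 : WithTop ℕ∞) ≤ 2 by norm_num)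
  have hcomm := fun p (hp : p ∈ NRect r₀ r₁) => pdv2_comm h hψ er2 ez2 hp
  have hv0 : ∀ z ∈ Icc (-1 : ℝ) 1, pdv2 (closure (NRect r₀ r₁)) ez2 ψ (r₀, z) = 0 := by
    intro z hz
    have hp := mem (left_mem_Icc.2 h.le) hz
    have h1 := hasDerivWithinAt_slice_z h hp ((hψ1.differentiableOn (by norm_num)) _ hp)
    have h2 : HasDerivWithinAt (fun t => ψ (r₀, t)) 0 (Icc (-1) 1) z :=
      (hasDerivWithinAt_const z _ (0 : ℝ)).congr (fun t ht => (hends t ht).1) (hends z hz).1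
    exact (uniqueDiffOn_Icc (by norm_num) z hz).eq_deriv _ h1 h2
  generalize huu : pdv2 (closure (NRect r₀ r₁)) er2 ψ = u at *
  generalize hvv : pdv2 (closure (NRect r₀ r₁)) ez2 ψ = v at *
  generalize hPP : pdv2 (closure (NRect r₀ r₁)) er2 Ψ = P at *
  generalize hQQ : pdv2 (closure (NRect r₀ r₁)) ez2 Ψ = Q at *
  let F : ℝ × ℝ → ℝ := fun p => -((r₁ - p.1) * (-B11 p * u p ^ 2 + B22 p * v p ^ 2) / 2)
    - (r₁ - p.1) * ψ p ^ 2 + Ψ p * P p + K * ((p.1 - r₀) * Ψ p ^ 2)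
  let G : ℝ × ℝ → ℝ := fun p => (r₁ - p.1) * (B22 p * (u p * v p) + B12 p * u p ^ 2) + Ψ p * Q p
  have hw : ContDiffOn ℝ 1 (fun p : ℝ × ℝ => r₁ - p.1) (closure (NRect r₀ r₁)) := by fun_prop
  have hs : ContDiffOn ℝ 1 (fun p : ℝ × ℝ => p.1 - r₀) (closure (NRect r₀ r₁)) := by fun_prop
  have hF : ContDiffOn ℝ 1 F (closure (NRect r₀ r₁)) :=
    ((((hw.mul ((h11.neg.mul (hu.pow 2)).add (h22.mul (hv.pow 2)))).div_const 2).neg.sub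
      (hw.mul (hψ1.pow 2))).add (hΨ1.mul hP)).add (contDiffOn_const.mul (hs.mul (hΨ1.pow 2)))
  have hG : ContDiffOn ℝ 1 G (closure (NRect r₀ r₁)) :=
    (hw.mul ((h22.mul (hu.mul hv)).add (h12.mul (hu.pow 2)))).add (hΨ1.mul hQ)
  have hdiv := integral_NRect_divergence h hF hG
  have hpt : ∀ p ∈ NRect r₀ r₁,
      μ / 4 * (ψ p ^ 2 + u p ^ 2 + v p ^ 2 + Ψ p ^ 2 + P p ^ 2 + Q p ^ 2)
        - (G₄ p ^ 2 + G₅ p ^ 2)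
      ≤ pdv2 (closure (NRect r₀ r₁)) er2 F p + pdv2 (closure (NRect r₀ r₁)) ez2 G p := by
    intro p hp
    have hFr := hasDerivAt_slice_r h hF hp
    have hGz := hasDerivAt_slice_z h hG hp
    have hwr : HasDerivAt (fun t => r₁ - t) (-1) p.1 := (hasDerivAt_id p.1).const_sub r₁
    have hsr : HasDerivAt (fun t => t - r₀) 1 p.1 := (hasDerivAt_id p.1).sub_const r₀
    have d11 := hasDerivAt_slice_r h h11 hp
    have d22 := hasDerivAt_slice_r h h22 hp
    have du := hasDerivAt_slice_r h hu hp
    have dv := hasDerivAt_slice_r h hv hp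
    have dψ := hasDerivAt_slice_r h hψ1 hp
    have dΨ := hasDerivAt_slice_r h hΨ1 hp
    have dP := hasDerivAt_slice_r h hP hp
    have e12 := hasDerivAt_slice_z h h12 hp
    have e22 := hasDerivAt_slice_z h h22 hp
    have eu := hasDerivAt_slice_z h hu hp
    have ev := hasDerivAt_slice_z h hv hp
    have eΨ := hasDerivAt_slice_z h hΨ1 hp
    have eQ := hasDerivAt_slice_z h hQ hp
    have hFr' := hFr.unique
      (((((hwr.mul ((d11.neg.mul (du.pow 2)).add (d22.mul (dv.pow 2)))).div_const 2).neg.sub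
      (hwr.mul (dψ.pow 2))).add (dΨ.mul dP)).add ((hsr.mul (dΨ.pow 2)).const_mul K))
    have hGz' := hGz.unique
      ((((e22.mul (eu.mul ev)).add (e12.mul (eu.pow 2))).const_mul (r₁ - p.1)).add (eΨ.mul eQ))
    obtain ⟨ha₁, hU, hb₂, ha₂, hb₃, hi⟩ := hcoef p.1 hp.1
    obtain ⟨hAr, hDr, hDz, hbz⟩ := hdB p hp
    obtain ⟨hA, -, hD⟩ := hB p (subset_closure hp)
    have hw0 : 0 ≤ r₁ - p.1 := by linarith [hp.1.2]
    have hs0 : 0 ≤ p.1 - r₀ := by linarith [hp.1.1]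
    have key := energy_pointwise (ψ := ψ p) (u := u p) (v := v p) (Ψ := Ψ p) (P := P p)
      (Q := Q p) (g₄ := G₄ p) (g₅ := G₅ p) hμ hμ1 hM hK hw0 hs0
      ((mul_le_mul_of_nonneg_right (by linarith) (by linarith)).trans hL)
      ((mul_le_mul_of_nonneg_right (by linarith) hK0).trans hLK)
      hA hD ((abs_neg _).trans_le hAr) hDr hDz hbz ha₁ hU hb₂ ha₂ hb₃ hi
    refine key.trans_eq ?_
    rw [hFr', hGz', ← hhyp p hp, ← hell p hp]
    have hc := hcomm p hp
    simp only [huu, hPP, hQQ, Pi.mul_apply, Pi.add_apply, Pi.neg_apply, Pi.pow_apply,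
      Prod.mk.eta] at hc ⊢
    rw [hc]
    push_cast
    ring
  have hG1 : ∀ x ∈ Icc r₀ r₁, G (x, 1) = 0 := by
    intro x hx
    have hp := mem hx (right_mem_Icc.2 (by norm_num : (-1 : ℝ) ≤ 1))
    obtain ⟨h1, h2⟩ := hwalls _ hp (Or.inl rfl)
    simp only [G, h1, h2, hwall _ hp (Or.inl rfl)]
    ring
  have hG2 : ∀ x ∈ Icc r₀ r₁, G (x, -1) = 0 := by
    intro x hx
    have hp := mem hx (left_mem_Icc.2 (by norm_num : (-1 : ℝ) ≤ 1))
    obtain ⟨h1, h2⟩ := hwalls _ hp (Or.inr rfl)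
    simp only [G, h1, h2, hwall _ hp (Or.inr rfl)]
    ring
  have hF1 : ∀ z ∈ Icc (-1 : ℝ) 1, F (r₁, z) = 0 := by
    intro z hz
    simp only [F, (hends z hz).2.2.2]
    ring
  have hF0 : ∀ z ∈ Icc (-1 : ℝ) 1, -((r₁ - r₀) / (2 * μ) * G₆ z ^ 2) ≤ F (r₀, z) := by
    intro z hz
    obtain ⟨e1, e2, e3, -⟩ := hends z hz
    have hA := (hB _ (mem (left_mem_Icc.2 h.le) hz)).2.1
    have h1 := mul_le_mul_of_nonneg_right hA
      (show 0 ≤ (r₁ - r₀) / 2 * G₆ z ^ 2 from mul_nonneg (by linarith) (sq_nonneg _))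
    have h2 : 1 / μ * ((r₁ - r₀) / 2 * G₆ z ^ 2) = (r₁ - r₀) / (2 * μ) * G₆ z ^ 2 := by
      field_simp
    simp only [F, e1, e2, e3, hv0 z hz]
    linarith
  have hle1 : (-1 : ℝ) ≤ 1 := by norm_num
  have hflux : -((r₁ - r₀) / (2 * μ) * ∫ z in (-1 : ℝ)..1, (G₆ z) ^ 2)
      ≤ ∫ z in (-1 : ℝ)..1, F (r₀, z) := by
    rw [← intervalIntegral.integral_const_mul, ← intervalIntegral.integral_neg]
    refine intervalIntegral.integral_mono_on hle1 ?_ ?_ hF0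
    · refine ContinuousOn.intervalIntegrable ?_
      rw [uIcc_of_le hle1]
      exact (continuousOn_const.mul (hG₆.pow 2)).neg
    · refine ContinuousOn.intervalIntegrable ?_
      rw [uIcc_of_le hle1]
      exact hF.continuousOn.comp (by fun_prop) fun z hz => mem (left_mem_Icc.2 h.le) hz
  rw [intervalIntegral.integral_congr (g := fun _ => 0) (by rwa [uIcc_of_le h.le]),
    intervalIntegral.integral_congr (f := fun x => G (x, -1)) (g := fun _ => 0)
      (by rwa [uIcc_of_le h.le]),
    intervalIntegral.integral_congr (f := fun z => F (r₁, z)) (g := fun _ => 0)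
      (by rwa [uIcc_of_le hle1])] at hdiv
  simp only [intervalIntegral.integral_zero] at hdiv
  have hE := integrableOn_NRect h (((((hψ.continuousOn.pow 2).add (hu.continuousOn.pow 2)).add
    (hv.continuousOn.pow 2)).add (hΨ.continuousOn.pow 2)).add (hP.continuousOn.pow 2)
    |>.add (hQ.continuousOn.pow 2))
  have hg := integrableOn_NRect h ((hG₄.pow 2).add (hG₅.pow 2))
  have hmono := setIntegral_mono_on ((hE.const_mul (μ / 4)).sub hg)
    (integrableOn_NRect h ((continuousOn_pdv2 hS hF er2).add (continuousOn_pdv2 hS hG ez2)))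
    (isOpen_NRect r₀ r₁).measurableSet hpt
  have hsub := integral_sub (hE.const_mul (μ / 4)) hg
  have hcm := integral_const_mul (μ := volume.restrict (NRect r₀ r₁)) (μ / 4)
    (fun p => ψ p ^ 2 + u p ^ 2 + v p ^ 2 + Ψ p ^ 2 + P p ^ 2 + Q p ^ 2)
  simp only [Pi.add_apply, Pi.pow_apply, Pi.sub_apply] at hmono hsub hcm
  rw [hsub, hcm] at hmono
  linarith

lemma contDiffOn_c2Bar {γ S₀ J₀ r₀ T : ℝ} {U : ℝ → ℝ} (hr₀ : 0 < r₀) (hJ : 0 < J₀)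
    (hU : ContDiffOn ℝ 1 U (Ico r₀ T)) (hpos : ∀ r ∈ Ico r₀ T, 0 < U r) :
    ContDiffOn ℝ 1 (c2Bar γ S₀ J₀ U) (Ico r₀ T) := by
  have hrU : ∀ r ∈ Ico r₀ T, 0 < r * U r := fun r hr => mul_pos (hr₀.trans_le hr.1) (hpos r hr)
  have hρ : ContDiffOn ℝ 1 (rhoBar J₀ U) (Ico r₀ T) :=
    contDiffOn_const.div (contDiffOn_id.mul hU) fun r hr => (hrU r hr).ne'
  exact contDiffOn_const.mul (hρ.rpow_const_of_ne fun r hr => (div_pos hJ (hrU r hr)).ne')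

/-- Partial derivatives of a coefficient that is `C¹`-close to a radial function. -/
lemma abs_pdv2_le_of_close {r₀ r₁ T m : ℝ} (h : r₀ < r₁) (hT : r₁ < T) {b : ℝ → ℝ}
    (hb : ContDiffOn ℝ 1 b (Ico r₀ T)) (hm : ∀ r ∈ Ioo r₀ r₁, |derivWithin b (Ico r₀ T) r| ≤ m)
    {B : ℝ × ℝ → ℝ} (hB : ContDiffOn ℝ 1 B (closure (NRect r₀ r₁))) {p : ℝ × ℝ}
    (hp : p ∈ NRect r₀ r₁)
    (hclose : ‖fderivWithin ℝ (fun q : ℝ × ℝ => B q - b q.1) (closure (NRect r₀ r₁)) p‖ ≤ 1) :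
    |pdv2 (closure (NRect r₀ r₁)) er2 B p| ≤ 1 + m ∧
      |pdv2 (closure (NRect r₀ r₁)) ez2 B p| ≤ 1 := by
  have hbK : ContDiffOn ℝ 1 (fun q : ℝ × ℝ => b q.1) (closure (NRect r₀ r₁)) := by
    refine hb.comp contDiff_fst.contDiffOn fun q hq => ?_
    rw [closure_NRect h] at hq
    exact ⟨hq.1.1, hq.1.2.trans_lt hT⟩
  have hd : HasDerivAt b (derivWithin b (Ico r₀ T) p.1) p.1 :=
    (((hb.differentiableOn (by norm_num)) p.1 ⟨hp.1.1.le, hp.1.2.trans hT⟩).hasDerivWithinAt).hasDerivAt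
      (Ico_mem_nhds hp.1.1 (hp.1.2.trans hT))
  have hr := (hasDerivAt_slice_r h (hB.sub hbK) hp).unique
    ((hasDerivAt_slice_r h hB hp).sub hd)
  have hz := (hasDerivAt_slice_z h (hB.sub hbK) hp).unique
    ((hasDerivAt_slice_z h hB hp).sub (hasDerivAt_const p.2 (b p.1)))
  have hbound : ∀ e : ℝ × ℝ, ‖e‖ ≤ 1 →
      |pdv2 (closure (NRect r₀ r₁)) e (fun q : ℝ × ℝ => B q - b q.1) p| ≤ 1 := fun e he =>
    (ContinuousLinearMap.le_opNorm _ e).trans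
      ((mul_le_mul hclose he (norm_nonneg _) zero_le_one).trans_eq (one_mul 1))
  have h1 := hbound er2 (by simp [er2, Prod.norm_def])
  have h2 := hbound ez2 (by simp [ez2, Prod.norm_def])
  change pdv2 _ er2 (fun q : ℝ × ℝ => B q - b q.1) p = _ at hr
  change pdv2 _ ez2 (fun q : ℝ × ℝ => B q - b q.1) p = _ at hz
  rw [hr] at h1
  rw [hz, sub_zero] at h2
  refine ⟨?_, h2⟩
  have h3 := hm p.1 hp.1
  rw [abs_le] at *
  constructor <;> linarith

/-- A single constant bounding all background quantities away from the right endpoint. -/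
lemma exists_background_bound {γ r₀ S₀ J₀ T T' : ℝ} {U U' E : ℝ → ℝ} (hr₀ : 0 < r₀) (hJ : 0 < J₀)
    (hγ : 1 < γ) (hT : T' < T)
    (hU : ContDiffOn ℝ 1 U (Ico r₀ T)) (hE : ContinuousOn E (Ico r₀ T))
    (hpos : ∀ r ∈ Ico r₀ T, 0 < U r)
    (hsup : ∀ r ∈ Ico r₀ T, c2Bar γ S₀ J₀ U r < U r ^ 2)
    (hU' : ∀ r ∈ Ico r₀ T, U' r = (r * U r * E r + c2Bar γ S₀ J₀ U r * U r) /
      (r * (U r ^ 2 - c2Bar γ S₀ J₀ U r))) :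
    ∃ M, 1 ≤ M ∧ ∀ r ∈ Icc r₀ T', |a1Bar γ S₀ J₀ U U' E r| ≤ M ∧ |U r| ≤ M ∧
      |b2Bar γ U U' r| ≤ M ∧ |a2Bar γ S₀ J₀ U r| ≤ M ∧ 0 ≤ b3Bar γ S₀ J₀ U r ∧ |1 / r| ≤ M ∧
      1 + |derivWithin (B11Bar γ S₀ J₀ U) (Ico r₀ T) r| ≤ M ∧
      1 + |derivWithin (c2Bar γ S₀ J₀ U) (Ico r₀ T) r| ≤ M := by
  have hr : ∀ r ∈ Ico r₀ T, 0 < r := fun r h => hr₀.trans_le h.1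
  have hrU : ∀ r ∈ Ico r₀ T, 0 < r * U r := fun r h => mul_pos (hr r h) (hpos r h)
  have hρpos : ∀ r ∈ Ico r₀ T, 0 < rhoBar J₀ U r := fun r h => div_pos hJ (hrU r h)
  have hcpos : ∀ r ∈ Ico r₀ T, 0 < c2Bar γ S₀ J₀ U r := fun r h =>
    mul_pos (mul_pos (by linarith) (Real.exp_pos _)) (Real.rpow_pos_of_pos (hρpos r h) _)
  have hc := contDiffOn_c2Bar (γ := γ) (S₀ := S₀) hr₀ hJ hU hpos
  have hUD : UniqueDiffOn ℝ (Ico r₀ T) := uniqueDiffOn_Ico r₀ T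
  have cU := hU.continuousOn
  have cc := hc.continuousOn
  have cid : ContinuousOn (fun r : ℝ => r) (Ico r₀ T) := continuousOn_id
  have cρ : ContinuousOn (rhoBar J₀ U) (Ico r₀ T) :=
    continuousOn_const.div (cid.mul cU) fun r h => (hrU r h).ne'
  have cU' : ContinuousOn U' (Ico r₀ T) := by
    refine ContinuousOn.congr ?_ hU'
    exact (((cid.mul cU).mul hE).add (cc.mul cU)).div (cid.mul ((cU.pow 2).sub cc))
      fun r h => (mul_pos (hr r h) (sub_pos.2 (hsup r h))).ne'
  have ca₁ : ContinuousOn (a1Bar γ S₀ J₀ U U' E) (Ico r₀ T) :=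
    (((cc.sub (continuousOn_const.mul (cU.pow 2))).div cid fun r h => (hr r h).ne').sub
      (continuousOn_const.mul (cU.mul cU'))).add hE
  have cb₂ : ContinuousOn (b2Bar γ U U') (Ico r₀ T) :=
    (continuousOn_const.mul cU').add
      ((continuousOn_const.mul cU).div cid fun r h => (hr r h).ne')
  have ca₂ : ContinuousOn (a2Bar γ S₀ J₀ U) (Ico r₀ T) :=
    (cρ.mul cU).div cc fun r h => (hcpos r h).ne'
  have cinv : ContinuousOn (fun r : ℝ => 1 / r) (Ico r₀ T) :=
    continuousOn_const.div cid fun r h => (hr r h).ne'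
  have cB11 := (hc.sub (hU.pow 2)).continuousOn_derivWithin hUD le_rfl
  have cc' := hc.continuousOn_derivWithin hUD le_rfl
  have hsub : Icc r₀ T' ⊆ Ico r₀ T := fun r h => ⟨h.1, h.2.trans_lt hT⟩
  have bd : ∀ f : ℝ → ℝ, ContinuousOn f (Ico r₀ T) → ∃ m, ∀ r ∈ Icc r₀ T', |f r| ≤ m :=
    fun f hf => isCompact_Icc.exists_bound_of_continuousOn (hf.mono hsub)
  obtain ⟨m, hm⟩ := bd (fun r => |a1Bar γ S₀ J₀ U U' E r| + |U r| + |b2Bar γ U U' r|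
      + |a2Bar γ S₀ J₀ U r| + |1 / r| + |derivWithin (B11Bar γ S₀ J₀ U) (Ico r₀ T) r|
      + |derivWithin (c2Bar γ S₀ J₀ U) (Ico r₀ T) r|)
    ((((((ca₁.abs.add cU.abs).add cb₂.abs).add ca₂.abs).add cinv.abs).add cB11.abs).add cc'.abs)
  refine ⟨1 + |m|, by linarith [abs_nonneg m], fun r h => ?_⟩
  have h1 := (le_abs_self _).trans ((hm r h).trans (le_abs_self m))
  have n1 := abs_nonneg (a1Bar γ S₀ J₀ U U' E r)
  have n2 := abs_nonneg (U r)
  have n3 := abs_nonneg (b2Bar γ U U' r)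
  have n4 := abs_nonneg (a2Bar γ S₀ J₀ U r)
  have n5 := abs_nonneg (1 / r)
  have n6 := abs_nonneg (derivWithin (B11Bar γ S₀ J₀ U) (Ico r₀ T) r)
  have n7 := abs_nonneg (derivWithin (c2Bar γ S₀ J₀ U) (Ico r₀ T) r)
  refine ⟨?_, ?_, ?_, ?_, (div_pos (hρpos r (hsub h)) (hcpos r (hsub h))).le, ?_, ?_, ?_⟩ <;>
    linarith

/-- `H¹` energy estimate for the linearized axisymmetric
second-order hyperbolic–elliptic coupled system at a cylindrically symmetric
supersonic background Euler–Poisson flow, uniform over all smooth coefficients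
`B₁₁, B₁₂, B₂₂` that are `δ₁`-close in `C¹` to the background coefficients and
satisfy the stated structural conditions. -/
theorem stmt_6 (γ r₀ b₀ ρ₀ U₀ S₀ E₀ R₀ μ₂ ε₀ : ℝ)
    (Ubar Ebar U' E' : ℝ → ℝ)
    (hγ : 1 < γ) (hr₀ : 0 < r₀) (hb₀ : 0 < b₀) (hρ₀ : 0 < ρ₀)
    (hU₀ : 0 < U₀) (hS₀ : 0 < S₀) (hR₀ : 0 < R₀)
    (hμ₂ : μ₂ ∈ Ioo (0 : ℝ) 1) (hε₀ : ε₀ ∈ Ioo 0 R₀)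
    -- the background flow: a smooth solution of the background ODE system
    (hUsm : ContDiffOn ℝ (⊤ : ℕ∞) Ubar (Ico r₀ (r₀ + R₀)))
    (hEsm : ContDiffOn ℝ (⊤ : ℕ∞) Ebar (Ico r₀ (r₀ + R₀)))
    (hIC : Ubar r₀ = U₀ ∧ Ebar r₀ = E₀)
    (hode : ∀ r ∈ Ico r₀ (r₀ + R₀),
      HasDerivWithinAt Ubar (U' r) (Ico r₀ (r₀ + R₀)) r ∧
      HasDerivWithinAt Ebar (E' r) (Ico r₀ (r₀ + R₀)) r ∧
      U' r = (r * Ubar r * Ebar r + c2Bar γ S₀ (r₀ * ρ₀ * U₀) Ubar r * Ubar r) /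
          (r * ((Ubar r) ^ 2 - c2Bar γ S₀ (r₀ * ρ₀ * U₀) Ubar r)) ∧
      E' r = rhoBar (r₀ * ρ₀ * U₀) Ubar r - b₀ - Ebar r / r)
    (hsup : ∀ r ∈ Ico r₀ (r₀ + R₀),
      0 < Ubar r ∧
      c2Bar γ S₀ (r₀ * ρ₀ * U₀) Ubar r < (Ubar r) ^ 2 ∧
      (Ubar r) ^ 3 < 2 * r₀ * (r₀ * ρ₀ * U₀)) :
    ∃ rbar₁ ∈ Ioc r₀ (r₀ + R₀ - ε₀), ∃ δ₁ > (0 : ℝ),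
      ∀ r₁ ∈ Ioo r₀ rbar₁, ∃ C > (0 : ℝ),
        ∀ B11 B12 B22 : ℝ × ℝ → ℝ,
          -- smooth coefficients on the closure of N
          ContDiffOn ℝ (⊤ : ℕ∞) B11 (closure (NRect r₀ r₁)) →
          ContDiffOn ℝ (⊤ : ℕ∞) B12 (closure (NRect r₀ r₁)) →
          ContDiffOn ℝ (⊤ : ℕ∞) B22 (closure (NRect r₀ r₁)) →
          -- (a) pointwise bounds
          (∀ p ∈ closure (NRect r₀ r₁),
            μ₂ ≤ -B11 p ∧ -B11 p ≤ 1 / μ₂ ∧ μ₂ ≤ B22 p ∧ B22 p ≤ 1 / μ₂) →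
          -- (b) compatibility on the walls z = ±1
          (∀ p ∈ closure (NRect r₀ r₁), (p.2 = 1 ∨ p.2 = -1) → B12 p = 0) →
          -- (c) C¹-closeness to the background coefficients
          (∀ p ∈ closure (NRect r₀ r₁),
            |B11 p - B11Bar γ S₀ (r₀ * ρ₀ * U₀) Ubar p.1|
              + ‖fderivWithin ℝ (fun q : ℝ × ℝ =>
                  B11 q - B11Bar γ S₀ (r₀ * ρ₀ * U₀) Ubar q.1)
                  (closure (NRect r₀ r₁)) p‖ ≤ δ₁ ∧
            |B22 p - c2Bar γ S₀ (r₀ * ρ₀ * U₀) Ubar p.1|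
              + ‖fderivWithin ℝ (fun q : ℝ × ℝ =>
                  B22 q - c2Bar γ S₀ (r₀ * ρ₀ * U₀) Ubar q.1)
                  (closure (NRect r₀ r₁)) p‖ ≤ δ₁ ∧
            |B12 p| + ‖fderivWithin ℝ B12 (closure (NRect r₀ r₁)) p‖ ≤ δ₁) →
          ∀ ψ Ψ G₄ G₅ : ℝ × ℝ → ℝ, ∀ G₆ : ℝ → ℝ,
            ContDiffOn ℝ 2 ψ (closure (NRect r₀ r₁)) →
            ContDiffOn ℝ 2 Ψ (closure (NRect r₀ r₁)) →
            ContinuousOn G₄ (closure (NRect r₀ r₁)) →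
            ContinuousOn G₅ (closure (NRect r₀ r₁)) →
            ContinuousOn G₆ (Icc (-1 : ℝ) 1) →
            -- first (hyperbolic) equation in N
            (∀ p ∈ NRect r₀ r₁,
              B11 p * pdv2 (closure (NRect r₀ r₁)) er2
                  (pdv2 (closure (NRect r₀ r₁)) er2 ψ) p
                + B22 p * pdv2 (closure (NRect r₀ r₁)) ez2
                  (pdv2 (closure (NRect r₀ r₁)) ez2 ψ) p
                + 2 * B12 p * pdv2 (closure (NRect r₀ r₁)) ez2
                  (pdv2 (closure (NRect r₀ r₁)) er2 ψ) p
                + a1Bar γ S₀ (r₀ * ρ₀ * U₀) Ubar U' Ebar p.1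
                    * pdv2 (closure (NRect r₀ r₁)) er2 ψ p
                + Ubar p.1 * pdv2 (closure (NRect r₀ r₁)) er2 Ψ p
                + b2Bar γ Ubar U' p.1 * Ψ p
                = G₄ p) →
            -- second (elliptic) equation in N
            (∀ p ∈ NRect r₀ r₁,
              pdv2 (closure (NRect r₀ r₁)) er2
                  (pdv2 (closure (NRect r₀ r₁)) er2 Ψ) p
                + (1 / p.1) * pdv2 (closure (NRect r₀ r₁)) er2 Ψ p
                + pdv2 (closure (NRect r₀ r₁)) ez2
                  (pdv2 (closure (NRect r₀ r₁)) ez2 Ψ) p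
                + a2Bar γ S₀ (r₀ * ρ₀ * U₀) Ubar p.1
                    * pdv2 (closure (NRect r₀ r₁)) er2 ψ p
                - b3Bar γ S₀ (r₀ * ρ₀ * U₀) Ubar p.1 * Ψ p
                = G₅ p) →
            -- boundary conditions at the entrance and the exit
            (∀ z ∈ Icc (-1 : ℝ) 1,
              ψ (r₀, z) = 0 ∧
              pdv2 (closure (NRect r₀ r₁)) er2 ψ (r₀, z) = G₆ z ∧
              pdv2 (closure (NRect r₀ r₁)) er2 Ψ (r₀, z) = 0 ∧
              Ψ (r₁, z) = 0) →
            -- boundary conditions on the walls z = ±1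
            (∀ p ∈ closure (NRect r₀ r₁), (p.2 = 1 ∨ p.2 = -1) →
              pdv2 (closure (NRect r₀ r₁)) ez2 ψ p = 0 ∧
              pdv2 (closure (NRect r₀ r₁)) ez2 Ψ p = 0) →
            -- the H¹ energy estimate
            (∫ p in NRect r₀ r₁,
                ((ψ p) ^ 2 + (pdv2 (closure (NRect r₀ r₁)) er2 ψ p) ^ 2
                  + (pdv2 (closure (NRect r₀ r₁)) ez2 ψ p) ^ 2
                  + (Ψ p) ^ 2 + (pdv2 (closure (NRect r₀ r₁)) er2 Ψ p) ^ 2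
                  + (pdv2 (closure (NRect r₀ r₁)) ez2 Ψ p) ^ 2))
              ≤ C * ((∫ p in NRect r₀ r₁, ((G₄ p) ^ 2 + (G₅ p) ^ 2))
                  + ∫ z in (-1 : ℝ)..1, (G₆ z) ^ 2) := by
  have hJ : 0 < r₀ * ρ₀ * U₀ := by positivity
  have hone : (1 : WithTop ℕ∞) ≤ ((⊤ : ℕ∞) : WithTop ℕ∞) := by exact_mod_cast le_top
  have hU1 := hUsm.of_le hone
  have hpos := fun r hr => (hsup r hr).1
  obtain ⟨hε, hεR⟩ := hε₀
  obtain ⟨hμ, hμ1⟩ := hμ₂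
  obtain ⟨M, hM, hbd⟩ := exists_background_bound (T' := r₀ + R₀ - ε₀) hr₀ hJ hγ (by linarith)
    hU1 hEsm.continuousOn hpos (fun r hr => (hsup r hr).2.1) (fun r hr => (hode r hr).2.2.1)
  have hc := contDiffOn_c2Bar (γ := γ) (S₀ := S₀) hr₀ hJ hU1 hpos
  obtain ⟨X, hX⟩ : ∃ X, X = 20 * M + (2 + M ^ 2 + 2 * M ^ 2 / μ₂) := ⟨_, rfl⟩
  have hK0 : 0 ≤ 2 + M ^ 2 + 2 * M ^ 2 / μ₂ := by positivity
  have hX0 : 0 < X := by linarith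
  have hmin : 0 < min (R₀ - ε₀) (μ₂ / 8 / X) := lt_min (by linarith) (by positivity)
  refine ⟨r₀ + min (R₀ - ε₀) (μ₂ / 8 / X), ⟨by linarith, by
    linarith [min_le_left (R₀ - ε₀) (μ₂ / 8 / X)]⟩, 1, one_pos, ?_⟩
  rintro r₁ ⟨h, hr₁⟩
  have hr₁T : r₁ < r₀ + R₀ - ε₀ := by linarith [min_le_left (R₀ - ε₀) (μ₂ / 8 / X)]
  have hLX : (r₁ - r₀) * X ≤ μ₂ / 8 := by
    rw [← le_div_iff₀ hX0]
    linarith [min_le_right (R₀ - ε₀) (μ₂ / 8 / X)]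
  have hL : 0 < r₁ - r₀ := sub_pos.2 h
  refine ⟨4 / μ₂ * (1 + (r₁ - r₀) / (2 * μ₂)), by positivity, ?_⟩
  intro B11 B12 B22 h11 h12 h22 hB hwall hclose ψ Ψ G₄ G₅ G₆ hψ hΨ hG₄ hG₅ hG₆ hhyp hell hends hwalls
  have hbd' : ∀ r ∈ Ioo r₀ r₁, r ∈ Icc r₀ (r₀ + R₀ - ε₀) := fun r hr =>
    ⟨hr.1.le, by linarith [hr.2]⟩
  have key := coupled_energy_estimate h hμ hμ1 hM
    ((mul_le_mul_of_nonneg_left (by linarith) hL.le).trans hLX)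
    ((mul_le_mul_of_nonneg_left (by linarith) hL.le).trans hLX)
    (fun r hr => by
      obtain ⟨k1, k2, k3, k4, k5, k6, -, -⟩ := hbd r (hbd' r hr)
      exact ⟨k1, k2, k3, k4, k5, k6⟩)
    (h11.of_le hone) (h12.of_le hone) (h22.of_le hone)
    (fun p hp => ⟨(hB p hp).1, (hB p hp).2.1, (hB p hp).2.2.1⟩) hwall
    (fun p hp => by
      obtain ⟨c1, c2, c3⟩ := hclose p (subset_closure hp)
      have e1 := abs_pdv2_le_of_close (T := r₀ + R₀) (m := M - 1)
        (b := B11Bar γ S₀ (r₀ * ρ₀ * U₀) Ubar) h (by linarith) (hc.sub (hU1.pow 2))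
        (fun r hr => le_sub_iff_add_le'.2 (hbd r (hbd' r hr)).2.2.2.2.2.2.1) (h11.of_le hone) hp
        ((le_add_of_nonneg_left (abs_nonneg _)).trans c1)
      have e2 := abs_pdv2_le_of_close (T := r₀ + R₀) (m := M - 1) h (by linarith) hc
        (fun r hr => le_sub_iff_add_le'.2 (hbd r (hbd' r hr)).2.2.2.2.2.2.2) (h22.of_le hone) hp
        ((le_add_of_nonneg_left (abs_nonneg _)).trans c2)
      have e3 := abs_pdv2_le_of_close (T := r₀ + R₀) (b := fun _ => 0) (m := 0) h (by linarith)
        contDiffOn_const (fun r _ => by simp) (h12.of_le hone) hp (by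
          simp only [sub_zero]
          linarith [abs_nonneg (B12 p)])
      exact ⟨by linarith [e1.1], by linarith [e2.1], by linarith [e2.2], by linarith [e3.2]⟩)
    hψ hΨ hG₄ hG₅ hG₆ hhyp hell hends hwalls
  have i1 : 0 ≤ ∫ p in NRect r₀ r₁, ((G₄ p) ^ 2 + (G₅ p) ^ 2) :=
    integral_nonneg fun p => by positivity
  have i2 : 0 ≤ ∫ z in (-1 : ℝ)..1, (G₆ z) ^ 2 :=
    intervalIntegral.integral_nonneg (by norm_num) fun z _ => sq_nonneg _
  have hq : 0 ≤ (r₁ - r₀) / (2 * μ₂) := by positivity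
  have h4 := mul_le_mul_of_nonneg_left key (show 0 ≤ 4 / μ₂ by positivity)
  rw [← mul_assoc, show 4 / μ₂ * (μ₂ / 4) = 1 by field_simp, one_mul] at h4
  refine h4.trans ?_
  rw [mul_assoc]
  refine mul_le_mul_of_nonneg_left ?_ (by positivity)
  nlinarith [mul_nonneg hq i1]
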